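/- arXiv:1504.07788 — 2 statements merged into one kernel-verified Lean document; each statement's English description precedes it below -/
import Mathlib

section
/- For every n ≥ 1, the left-divisibility relation ≼ on the positive braid monoid B_n^+ is a lattice order (a partial order in which any two elements admit a greatest lower bound and a least upper bound), and the set of left-divisors of Δ_n has exactly n! elements and is a sublattice (closed under these least upper bounds and greatest lower bounds). -/
/-- The braid relations on the free monoid over `Fin m` (generator `i` stands for `σ_{i+1}`):
`σ_i σ_j = σ_j σ_i` for `|i − j| ≥ 2` and `σ_i σ_j σ_i = σ_j σ_i σ_j` for `|i − j| = 1`. -/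
def BraidRel (m : ℕ) : FreeMonoid (Fin m) → FreeMonoid (Fin m) → Prop := fun u v =>
  (∃ i j : Fin m, (i : ℕ) + 2 ≤ (j : ℕ) ∧
    u = FreeMonoid.of i * FreeMonoid.of j ∧ v = FreeMonoid.of j * FreeMonoid.of i) ∨
  (∃ i j : Fin m, (i : ℕ) + 1 = (j : ℕ) ∧
    u = FreeMonoid.of i * FreeMonoid.of j * FreeMonoid.of i ∧
    v = FreeMonoid.of j * FreeMonoid.of i * FreeMonoid.of j)

/-- The positive braid monoid `B_n^+`, presented by the generators `σ_1, …, σ_{n−1}`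
and the braid relations. -/
abbrev PosBraid (n : ℕ) := (conGen (BraidRel (n - 1))).Quotient

/-- The generator `σ_{j+1}` of `B_n^+` (0-based index `j`), with junk value `1` out of range. -/
def braidSigma (n : ℕ) (j : ℕ) : PosBraid n :=
  if h : j < n - 1 then (conGen (BraidRel (n - 1))).mk' (FreeMonoid.of (⟨j, h⟩ : Fin (n - 1)))
  else 1

/-- `braidDelta n k` is Garside's element `Δ_k` inside `B_n^+`:
`Δ_1 = 1` and `Δ_{k+1} = Δ_k · σ_k σ_{k−1} ⋯ σ_1`. -/
def braidDelta (n : ℕ) : ℕ → PosBraid n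
  | 0 => 1
  | k + 1 => braidDelta n k * (((List.range k).reverse).map (braidSigma n)).prod

/-- Left-divisibility: `f ≼ g` iff `f * c = g` for some `c`. -/
def LDvd {M : Type*} [Monoid M] (f g : M) : Prop := ∃ c, f * c = g

namespace PosBraid

/-- The generator `σ_{i+1}` of the positive braid monoid, indexed by `Fin (n - 1)`. -/
def gen (n : ℕ) (i : Fin (n - 1)) : PosBraid n :=
  (conGen (BraidRel (n - 1))).mk' (FreeMonoid.of i)

/-- Two generator indices are far when the generators commute by a defining relation. -/
def Far {m : ℕ} (i j : Fin m) : Prop := (i : ℕ) + 2 ≤ j ∨ (j : ℕ) + 2 ≤ i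

/-- Two generator indices are adjacent when they differ by one. -/
def Adj {m : ℕ} (i j : Fin m) : Prop := (i : ℕ) + 1 = j ∨ (j : ℕ) + 1 = i

lemma eq_or_far_or_adj {m : ℕ} (i j : Fin m) : i = j ∨ Far i j ∨ Adj i j := by
  unfold Far Adj
  rw [Fin.ext_iff]
  omega

lemma Far.symm {m : ℕ} {i j : Fin m} (h : Far i j) : Far j i := Or.symm h

lemma Adj.symm {m : ℕ} {i j : Fin m} (h : Adj i j) : Adj j i := Or.symm h

variable {n : ℕ}

lemma braidSigma_of_lt {j : ℕ} (h : j < n - 1) : braidSigma n j = gen n ⟨j, h⟩ := by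
  simp [braidSigma, gen, h]

lemma mk_eq_of_braidRel {u v : FreeMonoid (Fin (n - 1))} (h : BraidRel (n - 1) u v) :
    (conGen (BraidRel (n - 1))).mk' u = (conGen (BraidRel (n - 1))).mk' v :=
  (Con.eq _).2 (ConGen.Rel.of _ _ h)

lemma gen_comm {i j : Fin (n - 1)} (h : Far i j) : gen n i * gen n j = gen n j * gen n i := by
  rcases h with h | h
  · exact mk_eq_of_braidRel (Or.inl ⟨i, j, h, rfl, rfl⟩)
  · exact (mk_eq_of_braidRel (Or.inl ⟨j, i, h, rfl, rfl⟩)).symm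

lemma gen_braid {i j : Fin (n - 1)} (h : Adj i j) :
    gen n i * gen n j * gen n i = gen n j * gen n i * gen n j := by
  rcases h with h | h
  · exact mk_eq_of_braidRel (Or.inr ⟨i, j, h, rfl, rfl⟩)
  · exact (mk_eq_of_braidRel (Or.inr ⟨j, i, h, rfl, rfl⟩)).symm

lemma gen_comm_mul {i j : Fin (n - 1)} (h : Far i j) (x : PosBraid n) :
    gen n i * (gen n j * x) = gen n j * (gen n i * x) := by
  rw [← mul_assoc, gen_comm h, mul_assoc]

lemma gen_braid_mul {i j : Fin (n - 1)} (h : Adj i j) (x : PosBraid n) :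
    gen n i * (gen n j * (gen n i * x)) = gen n j * (gen n i * (gen n j * x)) := by
  rw [← mul_assoc, ← mul_assoc, gen_braid h, mul_assoc, mul_assoc]

lemma induction_left {p : PosBraid n → Prop} (one : p 1)
    (gen_mul : ∀ i x, p x → p (gen n i * x)) (x : PosBraid n) : p x := by
  induction x using Con.induction_on with
  | H w =>
    induction w using FreeMonoid.inductionOn' with
    | one => exact one
    | of_mul i w ih => exact gen_mul i _ ih

lemma induction_right {p : PosBraid n → Prop} (one : p 1)
    (mul_gen : ∀ i x, p x → p (x * gen n i)) (x : PosBraid n) : p x := by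
  have key : ∀ y, p y → p (y * x) := by
    induction x using induction_left with
    | one => simp
    | gen_mul i x ih =>
      intro y hy
      rw [← mul_assoc]
      exact ih _ (mul_gen i y hy)
  simpa using key 1 one

/-- The word length as a monoid homomorphism. -/
def lenHom (n : ℕ) : PosBraid n →* Multiplicative ℕ :=
  Con.lift _ (FreeMonoid.lift fun _ => Multiplicative.ofAdd 1) <| Con.conGen_le.2 <| by
    rintro _ _ (⟨i, j, -, rfl, rfl⟩ | ⟨i, j, -, rfl, rfl⟩) <;> rfl

/-- The word length. -/
def len (x : PosBraid n) : ℕ := (lenHom n x).toAdd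

@[simp] lemma len_one : len (1 : PosBraid n) = 0 := by simp [len]

@[simp] lemma len_mul (x y : PosBraid n) : len (x * y) = len x + len y := by simp [len]

@[simp] lemma len_gen (i : Fin (n - 1)) : len (gen n i) = 1 := rfl

lemma eq_one_of_len_eq_zero {x : PosBraid n} (h : len x = 0) : x = 1 := by
  induction x using induction_left with
  | one => rfl
  | gen_mul i x _ => simp at h

lemma eq_one_or_eq_gen_mul (x : PosBraid n) : x = 1 ∨ ∃ i y, x = gen n i * y := by
  induction x using induction_left with
  | one => exact Or.inl rfl
  | gen_mul i x _ => exact Or.inr ⟨i, x, rfl⟩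

/-- `gen i * x` and `gen j * y` agree because both are the same right multiple of the
least common right multiple of `gen i` and `gen j`. -/
def HeadRel (i : Fin (n - 1)) (x : PosBraid n) (j : Fin (n - 1)) (y : PosBraid n) : Prop :=
  (i = j ∧ x = y) ∨
  (Far i j ∧ ∃ z, x = gen n j * z ∧ y = gen n i * z) ∨
  (Adj i j ∧ ∃ z, x = gen n j * (gen n i * z) ∧ y = gen n i * (gen n j * z))

namespace HeadRel

variable {i j k : Fin (n - 1)} {x y w : PosBraid n}

lemma eq_of_refl (h : HeadRel i x i y) : x = y := by
  rcases h with ⟨-, h⟩ | ⟨h, -⟩ | ⟨h, -⟩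
  · exact h
  · unfold Far at h; omega
  · unfold Adj at h; omega

lemma of_far (h : HeadRel i x j y) (hij : Far i j) :
    ∃ z, x = gen n j * z ∧ y = gen n i * z := by
  rcases h with ⟨rfl, -⟩ | ⟨-, h⟩ | ⟨h, -⟩
  · unfold Far at hij; omega
  · exact h
  · unfold Far at hij; unfold Adj at h; omega

lemma of_adj (h : HeadRel i x j y) (hij : Adj i j) :
    ∃ z, x = gen n j * (gen n i * z) ∧ y = gen n i * (gen n j * z) := by
  rcases h with ⟨rfl, -⟩ | ⟨h, -⟩ | ⟨-, h⟩
  · unfold Adj at hij; omega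
  · unfold Far at h; unfold Adj at hij; omega
  · exact h

lemma symm (h : HeadRel i x j y) : HeadRel j y i x := by
  rcases h with ⟨h, h'⟩ | ⟨h, z, hx, hy⟩ | ⟨h, z, hx, hy⟩
  · exact Or.inl ⟨h.symm, h'.symm⟩
  · exact Or.inr (Or.inl ⟨h.symm, z, hy, hx⟩)
  · exact Or.inr (Or.inr ⟨h.symm, z, hy, hx⟩)

lemma mul_right (h : HeadRel i x j y) (z : PosBraid n) : HeadRel i (x * z) j (y * z) := by
  rcases h with ⟨h, rfl⟩ | ⟨h, t, rfl, rfl⟩ | ⟨h, t, rfl, rfl⟩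
  · exact Or.inl ⟨h, rfl⟩
  · exact Or.inr (Or.inl ⟨h, t * z, by simp only [mul_assoc], by simp only [mul_assoc]⟩)
  · exact Or.inr (Or.inr ⟨h, t * z, by simp only [mul_assoc], by simp only [mul_assoc]⟩)

/-- Transitivity of `HeadRel`, assuming that equalities with shorter tails come from `HeadRel`;
this is Garside's cube condition on triples of generators. -/
lemma trans (ih : ∀ (a b : Fin (n - 1)) (u v : PosBraid n), len u < len w →
      gen n a * u = gen n b * v → HeadRel a u b v)
    (h₁ : HeadRel i x k w) (h₂ : HeadRel k w j y) : HeadRel i x j y := by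
  rcases h₁ with ⟨rfl, rfl⟩ | ⟨hik, z, rfl, hw⟩ | ⟨hik, z, rfl, hw⟩
  · exact h₂
  · rcases h₂ with ⟨rfl, rfl⟩ | ⟨hkj, z', hw', rfl⟩ | ⟨hkj, z', hw', rfl⟩
    · exact Or.inr (Or.inl ⟨hik, z, rfl, hw⟩)
    · have h := ih i j z z' (by simp [hw]) (hw.symm.trans hw')
      rcases eq_or_far_or_adj i j with rfl | hij | hij
      · exact Or.inl ⟨rfl, by rw [h.eq_of_refl]⟩
      · obtain ⟨v, rfl, rfl⟩ := h.of_far hij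
        exact Or.inr (Or.inl ⟨hij, gen n k * v, gen_comm_mul hkj v, (gen_comm_mul hik v).symm⟩)
      · obtain ⟨v, rfl, rfl⟩ := h.of_adj hij
        refine Or.inr (Or.inr ⟨hij, gen n k * v, ?_, ?_⟩)
        · rw [gen_comm_mul hkj, gen_comm_mul hik.symm]
        · rw [gen_comm_mul hik.symm, gen_comm_mul hkj]
    · have h := ih i j z (gen n k * z') (by simp [hw]) (hw.symm.trans hw')
      have hl : len w = len z' + 2 := by simp [hw']; omega
      rcases eq_or_far_or_adj i j with rfl | hij | hij
      · unfold Far at hik; unfold Adj at hkj; omega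
      · obtain ⟨v, rfl, hv⟩ := h.of_far hij
        obtain ⟨u, rfl, rfl⟩ := (ih k i z' v (by omega) hv).of_far hik.symm
        refine Or.inr (Or.inl ⟨hij, gen n k * (gen n j * u), ?_, ?_⟩)
        · rw [gen_braid_mul hkj]
        · rw [gen_comm_mul hij.symm, gen_comm_mul hik.symm]
      · obtain ⟨v, rfl, hv⟩ := h.of_adj hij
        obtain ⟨u, rfl, hu⟩ := (ih k i z' _ (by omega) hv).of_far hik.symm
        simp only [len_mul, len_gen] at hl
        obtain ⟨t, rfl, rfl⟩ := (ih j k v u (by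
          have := congrArg len hu; simp at this; omega) hu).of_adj hkj.symm
        refine Or.inr (Or.inr ⟨hij, gen n k * (gen n j * (gen n i * t)), ?_, ?_⟩)
        · rw [gen_comm_mul hik, gen_braid_mul hkj, gen_braid_mul hij.symm, gen_comm_mul hik.symm]
        · rw [gen_braid_mul hij.symm, gen_comm_mul hik, gen_comm_mul hik.symm,
            gen_braid_mul hkj]
  · rcases h₂ with ⟨rfl, rfl⟩ | ⟨hkj, z', hw', rfl⟩ | ⟨hkj, z', hw', rfl⟩
    · exact Or.inr (Or.inr ⟨hik, z, rfl, hw⟩)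
    · have h := ih j i z' (gen n k * z) (by simp [hw']) (hw'.symm.trans hw)
      have hl : len w = len z + 2 := by simp [hw]; omega
      rcases eq_or_far_or_adj j i with rfl | hij | hij
      · unfold Far at hkj; unfold Adj at hik; omega
      · obtain ⟨v, rfl, hv⟩ := h.of_far hij
        obtain ⟨u, rfl, rfl⟩ := (ih k j z v (by omega) hv).of_far hkj
        refine Or.inr (Or.inl ⟨hij.symm, gen n k * (gen n i * u), ?_, ?_⟩)
        · rw [gen_comm_mul hij.symm, gen_comm_mul hkj]
        · rw [gen_braid_mul hik.symm]
      · obtain ⟨v, rfl, hv⟩ := h.of_adj hij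
        obtain ⟨u, rfl, hu⟩ := (ih k j z _ (by omega) hv).of_far hkj
        simp only [len_mul, len_gen] at hl
        obtain ⟨t, rfl, rfl⟩ := (ih i k v u (by
          have := congrArg len hu; simp at this; omega) hu).of_adj hik
        refine Or.inr (Or.inr ⟨hij.symm, gen n k * (gen n i * (gen n j * t)), ?_, ?_⟩)
        · rw [gen_braid_mul hij.symm, gen_comm_mul hkj.symm, gen_comm_mul hkj,
            gen_braid_mul hik.symm]
        · rw [gen_comm_mul hkj.symm, gen_braid_mul hik.symm, gen_braid_mul hij.symm,
            gen_comm_mul hkj]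
    · have h := ih i j (gen n k * z) (gen n k * z') (by simp [hw]) (hw.symm.trans hw')
      have hl : len w = len z + 2 := by simp [hw]; omega
      have hl' : len w = len z' + 2 := by simp [hw']; omega
      rcases eq_or_far_or_adj i j with rfl | hij | hij
      · have hz := (ih k k z z' (by omega) h.eq_of_refl).eq_of_refl
        exact Or.inl ⟨rfl, by rw [hz]⟩
      · obtain ⟨v, hv, hv'⟩ := h.of_far hij
        obtain ⟨u, rfl, hu⟩ := (ih k j z v (by omega) hv).of_adj hkj
        obtain ⟨t, rfl, ht⟩ := (ih k i z' v (by omega) hv').of_adj hik.symm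
        simp only [len_mul, len_gen] at hl hl'
        have hut := (ih k k _ _ (by simp; omega) (hu.symm.trans ht)).eq_of_refl
        obtain ⟨r, rfl, rfl⟩ := (ih j i u t (by omega) hut).of_far hij.symm
        refine Or.inr (Or.inl ⟨hij,
          gen n k * (gen n j * (gen n i * (gen n k * r))), ?_, ?_⟩)
        · rw [gen_comm_mul hij, gen_braid_mul hik, gen_braid_mul hkj]
        · rw [gen_comm_mul hij.symm, gen_braid_mul hkj.symm, gen_braid_mul hik.symm,
            gen_comm_mul hij]
      · unfold Adj at hij hik hkj; omega

end HeadRel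

lemma headRel_of_conGen (N : ℕ) {u v : FreeMonoid (Fin (n - 1))}
    (h : ConGen.Rel (BraidRel (n - 1)) u v)
    (hN : len ((conGen (BraidRel (n - 1))).mk' u) ≤ N) :
    (u = 1 ∧ v = 1) ∨ ∃ i j u' v', u = FreeMonoid.of i * u' ∧ v = FreeMonoid.of j * v' ∧
      HeadRel i ((conGen (BraidRel (n - 1))).mk' u') j ((conGen (BraidRel (n - 1))).mk' v') := by
  induction N using Nat.strong_induction_on generalizing u v with
  | _ N ihN =>
  have hmk : ∀ {u v : FreeMonoid (Fin (n - 1))}, ConGen.Rel (BraidRel (n - 1)) u v →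
      (conGen (BraidRel (n - 1))).mk' u = (conGen (BraidRel (n - 1))).mk' v :=
    fun h => (Con.eq _).2 h
  induction h with
  | of u v h =>
    rcases h with ⟨i, j, h, rfl, rfl⟩ | ⟨i, j, h, rfl, rfl⟩
    · exact Or.inr ⟨i, j, _, _, rfl, rfl,
        Or.inr (Or.inl ⟨Or.inl h, 1, by simp [gen], by simp [gen]⟩)⟩
    · refine Or.inr ⟨i, j, FreeMonoid.of j * FreeMonoid.of i, FreeMonoid.of i * FreeMonoid.of j,
        by rw [mul_assoc], by rw [mul_assoc], Or.inr (Or.inr ⟨Or.inl h, 1, ?_, ?_⟩)⟩ <;>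
      simp [gen]
  | refl u =>
    induction u using FreeMonoid.inductionOn' with
    | one => exact Or.inl ⟨rfl, rfl⟩
    | of_mul i u _ => exact Or.inr ⟨i, i, u, u, rfl, rfl, Or.inl ⟨rfl, rfl⟩⟩
  | symm h ih =>
    rcases ih (by rwa [hmk h]) with ⟨h₁, h₂⟩ | ⟨i, j, u', v', h₁, h₂, h₃⟩
    · exact Or.inl ⟨h₂, h₁⟩
    · exact Or.inr ⟨j, i, v', u', h₂, h₁, h₃.symm⟩
  | @trans u v w h h' ih ih' =>
    have hv : len ((conGen (BraidRel (n - 1))).mk' v) ≤ N := by rwa [← hmk h]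
    rcases ih hN with ⟨h₁, h₂⟩ | ⟨i, j, u', v', h₁, h₂, h₃⟩
    · rcases ih' hv with ⟨h₁', h₂'⟩ | ⟨i', j', v'', w', h₁', h₂', h₃'⟩
      · exact Or.inl ⟨h₁, h₂'⟩
      · rw [h₂] at h₁'
        exact absurd (congrArg FreeMonoid.length h₁') (by simp; omega)
    · rcases ih' hv with ⟨h₁', h₂'⟩ | ⟨i', j', v'', w', h₁', h₂', h₃'⟩
      · rw [h₁'] at h₂
        exact absurd (congrArg FreeMonoid.length h₂) (by simp; omega)
      · obtain ⟨rfl, rfl⟩ : j = i' ∧ v' = v'' := List.cons.inj (h₂.symm.trans h₁')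
        refine Or.inr ⟨i, j', u', w', h₁, h₂', HeadRel.trans ?_ h₃ h₃'⟩
        intro a b x y hx hxy
        induction x using Con.induction_on with
        | H x =>
        induction y using Con.induction_on with
        | H y =>
        rw [h₂, map_mul, len_mul] at hv
        have h1 : len ((conGen (BraidRel (n - 1))).mk' (FreeMonoid.of j)) = 1 := rfl
        have hx' : len (x : PosBraid n) + 1 < N := by
          change len (x : PosBraid n) < _ at hx
          omega
        have hl : len ((conGen (BraidRel (n - 1))).mk' (FreeMonoid.of a * x)) ≤
            len (x : PosBraid n) + 1 := by
          rw [map_mul, len_mul, add_comm]; rfl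
        rcases ihN _ hx' (u := FreeMonoid.of a * x) (v := FreeMonoid.of b * y)
          ((Con.eq _).1 hxy) hl with ⟨h, -⟩ | ⟨p, q, x', y', hp, hq, hpq⟩
        · simpa using congrArg FreeMonoid.length h
        · obtain ⟨rfl, rfl⟩ : a = p ∧ x = x' := List.cons.inj hp
          obtain ⟨rfl, rfl⟩ : b = q ∧ y = y' := List.cons.inj hq
          exact hpq
  | @mul u v u' v' h h' ih ih' =>
    rw [map_mul, len_mul] at hN
    rcases ih (by omega) with ⟨rfl, rfl⟩ | ⟨i, j, w, w', rfl, rfl, h₃⟩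
    · simpa using ih' (by omega)
    · refine Or.inr ⟨i, j, w * u', w' * v', by rw [mul_assoc], by rw [mul_assoc], ?_⟩
      rw [map_mul, map_mul, ← hmk h']
      exact h₃.mul_right _

lemma headRel_of_gen_mul_eq {i j : Fin (n - 1)} {x y : PosBraid n}
    (h : gen n i * x = gen n j * y) : HeadRel i x j y := by
  induction x using Con.induction_on with
  | H x =>
  induction y using Con.induction_on with
  | H y =>
  rcases headRel_of_conGen _ (u := FreeMonoid.of i * x) (v := FreeMonoid.of j * y)
    ((Con.eq _).1 h) le_rfl with ⟨h, -⟩ | ⟨p, q, x', y', hp, hq, hpq⟩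
  · simpa using congrArg FreeMonoid.length h
  · obtain ⟨rfl, rfl⟩ : i = p ∧ x = x' := List.cons.inj hp
    obtain ⟨rfl, rfl⟩ : j = q ∧ y = y' := List.cons.inj hq
    exact hpq

/-- The positive braid monoid is left cancellative. -/
lemma mul_left_cancel' {x y z : PosBraid n} (h : x * y = x * z) : y = z := by
  induction x using induction_left with
  | one => simpa using h
  | gen_mul i x ih =>
    rw [mul_assoc, mul_assoc] at h
    exact ih (headRel_of_gen_mul_eq h).eq_of_refl

/-- Any two generators have a least common right multiple. -/
lemma exists_gen_lcm (i j : Fin (n - 1)) :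
    ∃ m, LDvd (gen n i) m ∧ LDvd (gen n j) m ∧
      ∀ e, LDvd (gen n i) e → LDvd (gen n j) e → LDvd m e := by
  rcases eq_or_far_or_adj i j with rfl | h | h
  · exact ⟨gen n i, ⟨1, mul_one _⟩, ⟨1, mul_one _⟩, fun _ h _ => h⟩
  · refine ⟨gen n i * gen n j, ⟨_, rfl⟩, ⟨_, (gen_comm h).symm⟩, ?_⟩
    rintro e ⟨x, hx⟩ ⟨y, hy⟩
    obtain ⟨z, rfl, -⟩ := (headRel_of_gen_mul_eq (hx.trans hy.symm)).of_far h
    exact ⟨z, by rw [mul_assoc, hx]⟩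
  · refine ⟨gen n i * (gen n j * gen n i), ⟨_, rfl⟩, ⟨gen n i * gen n j, ?_⟩, ?_⟩
    · rw [← mul_assoc, ← mul_assoc, gen_braid h]
    · rintro e ⟨x, hx⟩ ⟨y, hy⟩
      obtain ⟨z, rfl, -⟩ := (headRel_of_gen_mul_eq (hx.trans hy.symm)).of_adj h
      exact ⟨z, by rw [mul_assoc, mul_assoc, hx]⟩

lemma ldvd_refl (x : PosBraid n) : LDvd x x := ⟨1, mul_one x⟩

lemma ldvd_mul (x y : PosBraid n) : LDvd x (x * y) := ⟨y, rfl⟩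

lemma _root_.LDvd.trans {x y z : PosBraid n} (h : LDvd x y) (h' : LDvd y z) : LDvd x z := by
  obtain ⟨c, rfl⟩ := h
  obtain ⟨d, rfl⟩ := h'
  exact ⟨c * d, (mul_assoc _ _ _).symm⟩

lemma _root_.LDvd.len_le {x y : PosBraid n} (h : LDvd x y) : len x ≤ len y := by
  obtain ⟨c, rfl⟩ := h
  simp

lemma _root_.LDvd.mul_left {x y : PosBraid n} (h : LDvd x y) (z : PosBraid n) :
    LDvd (z * x) (z * y) := by
  obtain ⟨c, rfl⟩ := h
  exact ⟨c, mul_assoc _ _ _⟩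

lemma _root_.LDvd.of_mul_left {x y z : PosBraid n} (h : LDvd (z * x) (z * y)) : LDvd x y := by
  obtain ⟨c, hc⟩ := h
  exact ⟨c, mul_left_cancel' (by rw [← mul_assoc, hc])⟩

lemma _root_.LDvd.eq_of_len_le {x y : PosBraid n} (h : LDvd x y) (hl : len y ≤ len x) : x = y := by
  obtain ⟨c, rfl⟩ := h
  rw [len_mul] at hl
  rw [eq_one_of_len_eq_zero (x := c) (by omega), mul_one]

/-- A bounded set of elements closed under left-divisors and under joins of atomic extensions
has a greatest element. -/
lemma exists_greatest {p : PosBraid n → Prop} {N : ℕ} (one : p 1) (hN : ∀ z, p z → len z ≤ N)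
    (down : ∀ y z, LDvd y z → p z → p y)
    (join : ∀ z i j, p (z * gen n i) → p (z * gen n j) →
      ∃ m, LDvd (gen n i) m ∧ LDvd (gen n j) m ∧ p (z * m)) :
    ∃ d, p d ∧ ∀ e, p e → LDvd e d := by
  have exists_max : ∀ k z, N - len z = k → p z →
      ∃ m, (p m ∧ ∀ i, ¬ p (m * gen n i)) ∧ LDvd z m := by
    intro k
    induction k using Nat.strong_induction_on with
    | _ k ih =>
    intro z hk hz
    by_cases h : ∀ i, ¬ p (z * gen n i)
    · exact ⟨z, ⟨hz, h⟩, ldvd_refl z⟩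
    · push Not at h
      obtain ⟨i, hi⟩ := h
      have hl := hN _ hi
      rw [len_mul, len_gen] at hl
      obtain ⟨m, hm, hzm⟩ := ih _ (by rw [len_mul, len_gen]; omega) _ rfl hi
      exact ⟨m, hm, (ldvd_mul _ _).trans hzm⟩
  have unique_max : ∀ k z, N - len z = k → ∀ m m', (p m ∧ ∀ i, ¬ p (m * gen n i)) →
      (p m' ∧ ∀ i, ¬ p (m' * gen n i)) → LDvd z m → LDvd z m' → m = m' := by
    intro k
    induction k using Nat.strong_induction_on with
    | _ k ih =>
    rintro z hk m m' hm hm' ⟨c, rfl⟩ ⟨c', rfl⟩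
    rcases eq_one_or_eq_gen_mul c with rfl | ⟨i, x, rfl⟩ <;>
      rcases eq_one_or_eq_gen_mul c' with rfl | ⟨j, y, rfl⟩
    · rfl
    · rw [mul_one] at hm
      exact absurd (down _ _ ((ldvd_mul _ _).mul_left z) hm'.1) (hm.2 j)
    · rw [mul_one] at hm'
      exact absurd (down _ _ ((ldvd_mul _ _).mul_left z) hm.1) (hm'.2 i)
    · have hi : p (z * gen n i) := down _ _ ((ldvd_mul _ _).mul_left z) hm.1
      have hj : p (z * gen n j) := down _ _ ((ldvd_mul _ _).mul_left z) hm'.1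
      obtain ⟨u, hiu, hju, hu⟩ := join z i j hi hj
      obtain ⟨q, hq, hzq⟩ := exists_max _ _ rfl hu
      have hli := hN _ hi
      rw [len_mul, len_gen] at hli
      exact (ih _ (by rw [len_mul, len_gen]; omega) (z * gen n i) rfl _ q hm hq
        ((ldvd_mul _ _).mul_left z) ((hiu.mul_left z).trans hzq)).trans
        (ih _ (by rw [len_mul, len_gen]; omega) (z * gen n j) rfl q _ hq hm'
          ((hju.mul_left z).trans hzq) ((ldvd_mul _ _).mul_left z))
  obtain ⟨d, hd, -⟩ := exists_max _ 1 rfl one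
  refine ⟨d, hd.1, fun e he => ?_⟩
  obtain ⟨m, hm, hem⟩ := exists_max _ e rfl he
  rwa [unique_max _ 1 rfl d m hd hm ⟨d, one_mul d⟩ ⟨m, one_mul m⟩]

/-- Greatest common left-divisors exist. -/
lemma exists_gcd (f g : PosBraid n) :
    ∃ d, LDvd d f ∧ LDvd d g ∧ ∀ e, LDvd e f → LDvd e g → LDvd e d := by
  have join : ∀ f z i j m, LDvd (z * gen n i) f → LDvd (z * gen n j) f →
      (∀ e, LDvd (gen n i) e → LDvd (gen n j) e → LDvd m e) → LDvd (z * m) f := by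
    rintro f z i j m ⟨x, rfl⟩ hj hm
    rw [mul_assoc] at hj ⊢
    exact (hm _ (ldvd_mul _ _) hj.of_mul_left).mul_left z
  obtain ⟨d, hd, hmax⟩ := exists_greatest (p := fun z => LDvd z f ∧ LDvd z g)
    ⟨⟨f, one_mul f⟩, ⟨g, one_mul g⟩⟩ (fun z hz => hz.1.len_le)
    (fun y z hyz hz => ⟨hyz.trans hz.1, hyz.trans hz.2⟩)
    (fun z i j hi hj => by
      obtain ⟨m, him, hjm, hm⟩ := exists_gen_lcm i j
      exact ⟨m, him, hjm, join f z i j m hi.1 hj.1 hm, join g z i j m hi.2 hj.2 hm⟩)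
  exact ⟨d, hd.1, hd.2, fun e hf hg => hmax e ⟨hf, hg⟩⟩

/-- Two elements with a common right multiple have a least common right multiple. -/
lemma exists_lcm {f g e : PosBraid n} (hf : LDvd f e) (hg : LDvd g e) :
    ∃ m, LDvd f m ∧ LDvd g m ∧ ∀ e, LDvd f e → LDvd g e → LDvd m e := by
  classical
  have hex : ∃ k, ∃ m, len m = k ∧ LDvd f m ∧ LDvd g m := ⟨_, e, rfl, hf, hg⟩
  obtain ⟨m, hlen, hfm, hgm⟩ := Nat.find_spec hex
  refine ⟨m, hfm, hgm, fun e hfe hge => ?_⟩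
  obtain ⟨d, hdm, hde, hd⟩ := exists_gcd m e
  have hle := Nat.find_min' hex ⟨d, rfl, hd f hfm hfe, hd g hgm hge⟩
  rwa [← hdm.eq_of_len_le (hlen.trans_le hle)]

lemma sigma_comm {i j : ℕ} (h : i + 2 ≤ j ∨ j + 2 ≤ i) :
    braidSigma n i * braidSigma n j = braidSigma n j * braidSigma n i := by
  by_cases hi : i < n - 1
  · by_cases hj : j < n - 1
    · rw [braidSigma_of_lt hi, braidSigma_of_lt hj]
      exact gen_comm h
    · simp [braidSigma, hj]
  · simp [braidSigma, hi]

lemma sigma_braid {i : ℕ} (h : i + 1 < n - 1) :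
    braidSigma n i * braidSigma n (i + 1) * braidSigma n i =
      braidSigma n (i + 1) * braidSigma n i * braidSigma n (i + 1) := by
  rw [braidSigma_of_lt h, braidSigma_of_lt (Nat.lt_of_succ_lt h)]
  exact gen_braid (Or.inl rfl)

/-- The product `σ_k σ_{k-1} ⋯ σ_{j+1}`, equal to `1` when `k ≤ j`. -/
def descending (n : ℕ) : ℕ → ℕ → PosBraid n
  | 0, _ => 1
  | k + 1, j => if j ≤ k then braidSigma n k * descending n k j else 1

lemma descending_of_le {k j : ℕ} (h : k ≤ j) : descending n k j = 1 := by
  cases k with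
  | zero => rfl
  | succ k => exact if_neg (by omega)

lemma descending_succ {k j : ℕ} (h : j ≤ k) :
    descending n (k + 1) j = braidSigma n k * descending n k j := if_pos h

lemma braidDelta_succ (k : ℕ) :
    braidDelta n (k + 1) = braidDelta n k * descending n k 0 := by
  rw [braidDelta]
  congr 1
  induction k with
  | zero => rfl
  | succ k ih => simp [List.range_succ, descending_succ, ← ih]

lemma descending_mul_sigma {k j : ℕ} (h : j < k) :
    descending n k (j + 1) * braidSigma n j = descending n k j := by
  induction k with
  | zero => omega
  | succ k ih =>
    rw [descending_succ (k := k) (j := j) (by omega)]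
    rcases Nat.lt_or_ge j k with hjk | hjk
    · rw [descending_succ hjk, mul_assoc, ih hjk]
    · obtain rfl : j = k := by omega
      rw [descending_of_le le_rfl, descending_of_le le_rfl, one_mul, mul_one]

lemma descending_mul_descending {k j : ℕ} (h : j ≤ k) :
    descending n k j * descending n j 0 = descending n k 0 := by
  induction k with
  | zero => rw [Nat.le_zero.1 h, descending_of_le le_rfl, one_mul]
  | succ k ih =>
    rcases Nat.lt_or_ge k j with hjk | hjk
    · obtain rfl : j = k + 1 := by omega
      rw [descending_of_le le_rfl, one_mul]
    · rw [descending_succ hjk, descending_succ (Nat.zero_le k), mul_assoc, ih hjk]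

lemma sigma_mul_descending_of_lt {i j : ℕ} (k : ℕ) (h : i + 1 < j) :
    braidSigma n i * descending n k j = descending n k j * braidSigma n i := by
  induction k with
  | zero => simp [descending]
  | succ k ih =>
    rcases Nat.lt_or_ge k j with hjk | hjk
    · rw [descending_of_le (by omega), one_mul, mul_one]
    · rw [descending_succ hjk, ← mul_assoc, sigma_comm (Or.inl (by omega)), mul_assoc, ih,
        mul_assoc]

lemma sigma_mul_descending_of_gt {i k : ℕ} (j : ℕ) (h : k < i) :
    braidSigma n i * descending n k j = descending n k j * braidSigma n i := by
  induction k with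
  | zero => simp [descending]
  | succ k ih =>
    rcases Nat.lt_or_ge k j with hjk | hjk
    · rw [descending_of_le (by omega), one_mul, mul_one]
    · rw [descending_succ hjk, ← mul_assoc, sigma_comm (Or.inr (by omega)), mul_assoc,
        ih (by omega), mul_assoc]

lemma sigma_mul_descending {i j k : ℕ} (hj : j ≤ i) (hi : i + 1 < k) (hk : k ≤ n - 1) :
    braidSigma n i * descending n k j = descending n k j * braidSigma n (i + 1) := by
  induction k with
  | zero => omega
  | succ k ih =>
    rw [descending_succ (by omega)]
    rcases Nat.lt_or_ge (i + 1) k with hik | hik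
    · rw [← mul_assoc, sigma_comm (Or.inl (by omega)), mul_assoc, ih hik (by omega), mul_assoc]
    · obtain rfl : k = i + 1 := by omega
      rw [descending_succ hj, ← mul_assoc, ← mul_assoc, sigma_braid (by omega), mul_assoc,
        mul_assoc, mul_assoc, mul_assoc, sigma_mul_descending_of_gt j (Nat.lt_succ_self i)]

/-- The submonoid generated by `σ_1, …, σ_{k-1}`. -/
def parabolic (n k : ℕ) : Submonoid (PosBraid n) :=
  Submonoid.closure {x | ∃ i, i + 1 < k ∧ x = braidSigma n i}

lemma sigma_mem_parabolic {i k : ℕ} (h : i + 1 < k) : braidSigma n i ∈ parabolic n k :=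
  Submonoid.subset_closure ⟨i, h, rfl⟩

lemma parabolic_mono {k l : ℕ} (h : k ≤ l) : parabolic n k ≤ parabolic n l :=
  Submonoid.closure_mono fun _ ⟨i, hi, hx⟩ => ⟨i, hi.trans_le h, hx⟩

lemma descending_mem_parabolic (k j : ℕ) : descending n k j ∈ parabolic n (k + 1) := by
  induction k with
  | zero => exact one_mem _
  | succ k ih =>
    rcases Nat.lt_or_ge k j with hjk | hjk
    · rw [descending_of_le (by omega)]
      exact one_mem _
    · rw [descending_succ hjk]
      exact mul_mem (sigma_mem_parabolic (by omega)) (parabolic_mono (by omega) ih)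

lemma braidDelta_mem_parabolic (k : ℕ) : braidDelta n k ∈ parabolic n k := by
  induction k with
  | zero => exact one_mem _
  | succ k ih =>
    rw [braidDelta_succ]
    exact mul_mem (parabolic_mono (by omega) ih) (descending_mem_parabolic k 0)

lemma exists_mul_descending_eq {k : ℕ} (hk : k ≤ n - 1) {c : PosBraid n}
    (hc : c ∈ parabolic n k) :
    ∃ c' ∈ parabolic n (k + 1), c * descending n k 0 = descending n k 0 * c' := by
  induction hc using Submonoid.closure_induction with
  | mem x hx =>
    obtain ⟨i, hi, rfl⟩ := hx
    exact ⟨_, sigma_mem_parabolic (by omega), sigma_mul_descending (Nat.zero_le i) hi hk⟩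
  | one => exact ⟨1, one_mem _, by rw [one_mul, mul_one]⟩
  | mul x y _ _ hx hy =>
    obtain ⟨x', hx', hxx'⟩ := hx
    obtain ⟨y', hy', hyy'⟩ := hy
    exact ⟨x' * y', mul_mem hx' hy', by rw [mul_assoc, hyy', ← mul_assoc, hxx', mul_assoc]⟩

lemma descending_mul_descending_zero {m k : ℕ} (hm : m < k) (hk : k ≤ n - 1) :
    descending n m 0 * descending n k 0 = descending n k 0 * descending n (m + 1) 1 := by
  induction m with
  | zero => rw [descending_of_le le_rfl, descending_of_le le_rfl, one_mul, mul_one]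
  | succ m ih =>
    rw [descending_succ (Nat.zero_le m), mul_assoc, ih (by omega), ← mul_assoc,
      sigma_mul_descending (Nat.zero_le m) hm hk, mul_assoc, ← descending_succ (by omega)]

lemma sigma_comm_of_mem_parabolic {i k : ℕ} (h : k ≤ i) {c : PosBraid n}
    (hc : c ∈ parabolic n k) : braidSigma n i * c = c * braidSigma n i := by
  induction hc using Submonoid.closure_induction with
  | mem x hx =>
    obtain ⟨j, hj, rfl⟩ := hx
    exact sigma_comm (Or.inr (by omega))
  | one => rw [one_mul, mul_one]
  | mul x y _ _ hx hy => rw [← mul_assoc, hx, mul_assoc, hy, mul_assoc]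

/-- Left multiplication of Garside's element by a generator is right multiplication by a
generator. -/
lemma exists_sigma_mul_braidDelta {k i : ℕ} (hk : k ≤ n) (hi : i + 1 < k) :
    ∃ j, j + 1 < k ∧ braidSigma n i * braidDelta n k = braidDelta n k * braidSigma n j := by
  induction k generalizing i with
  | zero => omega
  | succ k ih =>
    rw [braidDelta_succ]
    rcases Nat.lt_or_ge (i + 1) k with hik | hik
    · obtain ⟨j, hj, h⟩ := ih (by omega) hik
      refine ⟨j + 1, by omega, ?_⟩
      rw [← mul_assoc, h, mul_assoc, sigma_mul_descending (Nat.zero_le j) hj (by omega), mul_assoc]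
    · obtain rfl : k = i + 1 := by omega
      refine ⟨0, by omega, ?_⟩
      rw [braidDelta_succ, ← mul_assoc, ← mul_assoc,
        sigma_comm_of_mem_parabolic le_rfl (braidDelta_mem_parabolic i), mul_assoc, mul_assoc,
        mul_assoc, mul_assoc, ← mul_assoc (descending n i 0),
        descending_mul_descending_zero (by omega) (by omega), mul_assoc (descending n (i + 1) 0),
        descending_mul_sigma (Nat.succ_pos i), ← descending_mul_descending_zero (by omega) (by omega),
        ← mul_assoc (braidSigma n i), ← descending_succ (Nat.zero_le i)]

/-- The normal forms `d σ_k ⋯ σ_{j+1}`, with `d` a normal form on fewer strands, of the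
simple elements of the positive braid monoid on `k + 1` strands. -/
def simples (n : ℕ) : ℕ → Set (PosBraid n)
  | 0 => {1}
  | k + 1 => (fun p : PosBraid n × ℕ => p.1 * descending n k p.2) '' (simples n k ×ˢ Set.Iic k)

lemma mul_descending_mem_simples {k j : ℕ} {d : PosBraid n} (hd : d ∈ simples n k)
    (hj : j ≤ k) : d * descending n k j ∈ simples n (k + 1) :=
  ⟨(d, j), ⟨hd, hj⟩, rfl⟩

lemma one_mem_simples (k : ℕ) : (1 : PosBraid n) ∈ simples n k := by
  induction k with
  | zero => rfl
  | succ k ih =>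
    simpa [descending_of_le] using mul_descending_mem_simples ih le_rfl

lemma braidDelta_mem_simples (k : ℕ) : braidDelta n k ∈ simples n k := by
  induction k with
  | zero => rfl
  | succ k ih =>
    rw [braidDelta_succ]
    exact mul_descending_mem_simples ih (Nat.zero_le k)

lemma exists_mul_eq_braidDelta {k : ℕ} (hk : k ≤ n) {d : PosBraid n} (hd : d ∈ simples n k) :
    ∃ c ∈ parabolic n k, d * c = braidDelta n k := by
  induction k generalizing d with
  | zero => exact ⟨1, one_mem _, by rw [mul_one, show d = 1 from hd]; rfl⟩
  | succ k ih =>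
    obtain ⟨⟨d, j⟩, ⟨hd, hj⟩, rfl⟩ := hd
    obtain ⟨c, hc, hdc⟩ := ih (by omega) hd
    obtain ⟨c', hc', hcc'⟩ := exists_mul_descending_eq (by omega) hc
    have hj : j ≤ k := hj
    refine ⟨descending n j 0 * c', mul_mem (parabolic_mono (by omega)
      (descending_mem_parabolic j 0)) hc', ?_⟩
    dsimp only
    rw [braidDelta_succ, ← hdc, mul_assoc d c, hcc', ← descending_mul_descending hj]
    simp only [mul_assoc]

/-- The exchange property for simple elements. -/
lemma mul_sigma_mem_simples_or {k i : ℕ} (hk : k ≤ n) (hi : i + 1 < k) {d : PosBraid n}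
    (hd : d ∈ simples n k) :
    d * braidSigma n i ∈ simples n k ∨ ∃ d' ∈ simples n k, d = d' * braidSigma n i := by
  induction k generalizing i d with
  | zero => omega
  | succ k ih =>
    obtain ⟨⟨d, j⟩, ⟨hd, hj⟩, rfl⟩ := hd
    have hj : j ≤ k := hj
    have key : ∀ l, l + 1 < k →
        braidSigma n l * descending n k j = descending n k j * braidSigma n i →
        d * descending n k j * braidSigma n i ∈ simples n (k + 1) ∨
          ∃ d' ∈ simples n (k + 1), d * descending n k j = d' * braidSigma n i := by
      intro l hl h
      rcases ih (by omega) hl hd with h' | ⟨d', hd', rfl⟩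
      · left
        rw [mul_assoc, ← h, ← mul_assoc]
        exact mul_descending_mem_simples h' hj
      · right
        exact ⟨_, mul_descending_mem_simples hd' hj, by rw [mul_assoc, h, mul_assoc]⟩
    rcases Nat.lt_trichotomy i j with hij | rfl | hij
    · rcases Nat.lt_or_ge (i + 1) j with hij' | hij'
      · exact key i (by omega) (sigma_mul_descending_of_lt k hij')
      · obtain rfl : j = i + 1 := by omega
        left
        dsimp only
        rw [mul_assoc, descending_mul_sigma (by omega)]
        exact mul_descending_mem_simples hd (by omega)
    · right
      refine ⟨d * descending n k (i + 1), mul_descending_mem_simples hd (by omega), ?_⟩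
      rw [mul_assoc, descending_mul_sigma (by omega)]
    · obtain ⟨i, rfl⟩ : ∃ l, i = l + 1 := ⟨i - 1, by omega⟩
      exact key i (by omega) (sigma_mul_descending (by omega) (by omega) (by omega))

/-- The permutation of a positive braid, acting on `ℕ`. -/
def perm (n : ℕ) : PosBraid n →* Equiv.Perm ℕ :=
  Con.lift _ (FreeMonoid.lift fun i => Equiv.swap (i : ℕ) (i + 1)) <| Con.conGen_le.2 <| by
    rintro _ _ (⟨i, j, h, rfl, rfl⟩ | ⟨i, j, h, rfl, rfl⟩)
    · exact (Equiv.Perm.disjoint_swap_swap (by simp; omega)).commute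
    · rw [Con.ker_rel]
      simp only [map_mul, FreeMonoid.lift_eval_of, ← h]
      rw [Equiv.swap_mul_swap_mul_swap (by omega) (by omega), Equiv.swap_comm (i : ℕ),
        Equiv.swap_comm _ ((i : ℕ) + 1 + 1), Equiv.swap_mul_swap_mul_swap (by omega) (by omega),
        Equiv.swap_comm]

lemma perm_sigma {i : ℕ} (h : i < n - 1) : perm n (braidSigma n i) = Equiv.swap i (i + 1) := by
  rw [braidSigma_of_lt h]
  rfl

lemma perm_apply_of_mem_parabolic {k m : ℕ} (h : k ≤ m) {x : PosBraid n}
    (hx : x ∈ parabolic n k) : perm n x m = m := by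
  induction hx using Submonoid.closure_induction with
  | mem x hx =>
    obtain ⟨i, hi, rfl⟩ := hx
    by_cases hin : i < n - 1
    · rw [perm_sigma hin]
      exact Equiv.swap_apply_of_ne_of_ne (by omega) (by omega)
    · simp [braidSigma, hin]
  | one => simp
  | mul x y _ _ hx hy => rw [map_mul, Equiv.Perm.mul_apply, hy, hx]

lemma perm_descending_apply {k j : ℕ} (hj : j ≤ k) (hk : k ≤ n - 1) :
    perm n (descending n k j) j = k := by
  induction k with
  | zero => simp [descending]; omega
  | succ k ih =>
    rcases Nat.lt_or_ge k j with hjk | hjk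
    · obtain rfl : j = k + 1 := by omega
      simp [descending_of_le]
    · rw [descending_succ hjk, map_mul, Equiv.Perm.mul_apply, ih hjk (by omega),
        perm_sigma (by omega), Equiv.swap_apply_left]

lemma simples_subset_parabolic (k : ℕ) : simples n k ⊆ parabolic n k := by
  induction k with
  | zero => rintro _ rfl; exact one_mem _
  | succ k ih =>
    rintro _ ⟨⟨d, j⟩, ⟨hd, -⟩, rfl⟩
    exact mul_mem (parabolic_mono (by omega) (ih hd)) (descending_mem_parabolic k j)

lemma eq_and_perm_eq_of_perm_mul_descending_eq {k j j' : ℕ} (hk : k ≤ n - 1)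
    {d d' : PosBraid n} (hd : d ∈ simples n k) (hd' : d' ∈ simples n k) (hj : j ≤ k)
    (hj' : j' ≤ k)
    (h : perm n (d * descending n k j) = perm n (d' * descending n k j')) :
    j = j' ∧ perm n d = perm n d' := by
  have apply_eq : ∀ {d j}, d ∈ simples n k → j ≤ k → perm n (d * descending n k j) j = k := by
    intro d j hd hj
    rw [map_mul, Equiv.Perm.mul_apply, perm_descending_apply hj hk,
      perm_apply_of_mem_parabolic le_rfl (simples_subset_parabolic k hd)]
  obtain rfl : j = j' := (perm n (d * descending n k j)).injective <| by
    rw [apply_eq hd hj, h, apply_eq hd' hj']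
  rw [map_mul, map_mul] at h
  exact ⟨rfl, mul_right_cancel h⟩

lemma perm_injOn_simples {k : ℕ} (hk : k ≤ n) : Set.InjOn (perm n) (simples n k) := by
  induction k with
  | zero => rintro _ rfl _ rfl _; rfl
  | succ k ih =>
    rintro _ ⟨⟨d, j⟩, ⟨hd, hj⟩, rfl⟩ _ ⟨⟨d', j'⟩, ⟨hd', hj'⟩, rfl⟩ h
    obtain ⟨rfl, h⟩ := eq_and_perm_eq_of_perm_mul_descending_eq (by omega) hd hd' hj hj' h
    obtain rfl : d = d' := ih (by omega) hd hd' h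
    rfl

lemma ncard_simples {k : ℕ} (hk : k ≤ n) : (simples n k).ncard = k.factorial := by
  induction k with
  | zero => exact Set.ncard_singleton _
  | succ k ih =>
    rw [simples, Set.InjOn.ncard_image, Set.ncard_prod, ih (by omega), Nat.factorial_succ,
      mul_comm]
    · congr 1
      rw [← Finset.coe_Iic, Set.ncard_coe_finset, Nat.card_Iic]
    · rintro ⟨d, j⟩ ⟨hd, hj⟩ ⟨d', j'⟩ ⟨hd', hj'⟩ h
      obtain ⟨rfl, h⟩ := eq_and_perm_eq_of_perm_mul_descending_eq (by omega) hd hd' hj hj'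
        (congrArg (perm n) h)
      obtain rfl : d = d' := perm_injOn_simples (by omega) hd hd' h
      rfl

/-- Every braid has the permutation of a simple element which is shorter unless the braid is
simple. -/
lemma exists_simple_perm_eq (x : PosBraid n) :
    ∃ d ∈ simples n n, perm n d = perm n x ∧ (x = d ∨ len d < len x) := by
  induction x using induction_right with
  | one => exact ⟨1, one_mem_simples n, rfl, Or.inl rfl⟩
  | mul_gen i x ih =>
    obtain ⟨d, hd, hperm, hlen⟩ := ih
    have hi : (i : ℕ) + 1 < n := by omega
    have hs : braidSigma n i = gen n i := braidSigma_of_lt i.2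
    rcases mul_sigma_mem_simples_or le_rfl hi hd with h | ⟨d', hd', rfl⟩
    · refine ⟨_, h, by rw [map_mul, map_mul, hperm, hs], ?_⟩
      rcases hlen with rfl | hlen
      · exact Or.inl (by rw [hs])
      · exact Or.inr (by simpa [hs] using hlen)
    · refine ⟨d', hd', ?_, Or.inr ?_⟩
      · rw [map_mul, ← hperm, map_mul, ← hs, mul_assoc, perm_sigma i.2, Equiv.swap_mul_self,
          mul_one]
      · rw [hs, len_mul, len_gen] at hlen
        rcases hlen with rfl | hlen
        · simp
        · rw [len_mul, len_gen]; omega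

lemma ldvd_braidDelta_iff {x : PosBraid n} : LDvd x (braidDelta n n) ↔ x ∈ simples n n := by
  refine ⟨fun ⟨c, hc⟩ => ?_, fun h => ?_⟩
  · obtain ⟨d, hd, hperm, rfl | hlen⟩ := exists_simple_perm_eq x
    · exact hd
    · obtain ⟨d', hd', hperm', hlen'⟩ := exists_simple_perm_eq (d * c)
      have h : d' = braidDelta n n := perm_injOn_simples le_rfl hd' (braidDelta_mem_simples n)
        (by rw [hperm', ← hc, map_mul, map_mul, hperm])
      have hle : len d' ≤ len (d * c) := by
        rcases hlen' with h | h
        · rw [h]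
        · exact h.le
      rw [h, ← hc, len_mul, len_mul] at hle
      omega
  · obtain ⟨c, -, hc⟩ := exists_mul_eq_braidDelta le_rfl h
    exact ⟨c, hc⟩

lemma sigma_ldvd_braidDelta {i : ℕ} (hi : i < n - 1) :
    LDvd (braidSigma n i) (braidDelta n n) := by
  rw [ldvd_braidDelta_iff]
  rcases mul_sigma_mem_simples_or (i := i) le_rfl (by omega) (one_mem_simples n) with h | ⟨d, -, hd⟩
  · rwa [one_mul] at h
  · have := congrArg len hd
    simp [braidSigma_of_lt hi] at this

lemma sigma_mul_braidDelta_pow {i : ℕ} (hi : i < n - 1) (r : ℕ) :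
    ∃ j < n - 1, braidSigma n i * braidDelta n n ^ r = braidDelta n n ^ r * braidSigma n j := by
  induction r with
  | zero => exact ⟨i, hi, by rw [pow_zero, one_mul, mul_one]⟩
  | succ r ih =>
    obtain ⟨j, hj, h⟩ := ih
    obtain ⟨l, hl, h'⟩ := exists_sigma_mul_braidDelta (k := n) (i := j) le_rfl (by omega)
    exact ⟨l, by omega, by rw [pow_succ, ← mul_assoc, h, mul_assoc, h', mul_assoc]⟩

lemma exists_ldvd_braidDelta_pow (x : PosBraid n) : ∃ r, LDvd x (braidDelta n n ^ r) := by
  induction x using induction_left with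
  | one => exact ⟨0, _, one_mul _⟩
  | gen_mul i x ih =>
    obtain ⟨r, hr⟩ := ih
    obtain ⟨j, hj, h⟩ := sigma_mul_braidDelta_pow i.2 r
    rw [braidSigma_of_lt i.2] at h
    refine ⟨r + 1, (hr.mul_left (gen n i)).trans ?_⟩
    rw [h, pow_succ]
    exact (sigma_ldvd_braidDelta hj).mul_left _

lemma exists_common_multiple (f g : PosBraid n) : ∃ e, LDvd f e ∧ LDvd g e := by
  obtain ⟨r, hr⟩ := exists_ldvd_braidDelta_pow f
  obtain ⟨s, hs⟩ := exists_ldvd_braidDelta_pow g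
  refine ⟨braidDelta n n ^ (r + s), hr.trans ?_, hs.trans ?_⟩
  · rw [pow_add]; exact ldvd_mul _ _
  · rw [add_comm, pow_add]; exact ldvd_mul _ _

end PosBraid

/-- For `n ≥ 1`, left-divisibility on `B_n^+` is a lattice order
(a partial order in which any two elements admit a greatest lower bound and a least
upper bound), the set of left-divisors of `Δ_n` has exactly `n!` elements, and it is a
sublattice (closed under these least upper bounds and greatest lower bounds). -/
theorem posBraid_leftDvd_lattice (n : ℕ) (hn : 1 ≤ n) :
    (∀ f : PosBraid n, LDvd f f) ∧
    (∀ f g h : PosBraid n, LDvd f g → LDvd g h → LDvd f h) ∧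
    (∀ f g : PosBraid n, LDvd f g → LDvd g f → f = g) ∧
    (∀ f g : PosBraid n, ∃ d, LDvd d f ∧ LDvd d g ∧ ∀ e, LDvd e f → LDvd e g → LDvd e d) ∧
    (∀ f g : PosBraid n, ∃ m, LDvd f m ∧ LDvd g m ∧ ∀ e, LDvd f e → LDvd g e → LDvd m e) ∧
    {d : PosBraid n | LDvd d (braidDelta n n)}.ncard = n.factorial ∧
    (∀ f g : PosBraid n, LDvd f (braidDelta n n) → LDvd g (braidDelta n n) →
      (∀ d, (LDvd d f ∧ LDvd d g ∧ ∀ e, LDvd e f → LDvd e g → LDvd e d) →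
        LDvd d (braidDelta n n)) ∧
      (∀ m, (LDvd f m ∧ LDvd g m ∧ ∀ e, LDvd f e → LDvd g e → LDvd m e) →
        LDvd m (braidDelta n n))) := by
  refine ⟨PosBraid.ldvd_refl, fun f g h => LDvd.trans,
    fun f g hfg hgf => LDvd.eq_of_len_le hfg (LDvd.len_le hgf),
    PosBraid.exists_gcd, fun f g => ?_, ?_, fun f g hf hg => ⟨fun d hd => ?_, fun m hm => ?_⟩⟩
  · obtain ⟨e, hf, hg⟩ := PosBraid.exists_common_multiple f g
    exact PosBraid.exists_lcm hf hg
  · simp only [PosBraid.ldvd_braidDelta_iff, Set.ofPred_mem_eq]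
    exact PosBraid.ncard_simples le_rfl
  · exact LDvd.trans hd.1 hf
  · exact hm.2.2 _ hf hg
end

section
/- Let (S, N) be a quadratic normalisation of class (4, 3), and consider the rewriting system on words over S whose steps replace a length-two factor s|t of a word by N̄(s|t) whenever s|t ≠ N̄(s|t). Then this rewriting system is terminating; more precisely, every rewriting sequence starting from a word of length p has length at most 2^p − p − 1. -/
/-- A normalisation `(S, N)`: a length-preserving map `N : S* → S*` fixing the letters
and compatible with itself on factors. -/
structure Normalisation (S : Type*) where
  /-- The normalisation map. -/
  N : List S → List S
  length_eq : ∀ w : List S, (N w).length = w.length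
  single : ∀ s : S, N [s] = [s]
  compat : ∀ u w v : List S, N (u ++ N w ++ v) = N (u ++ w ++ v)

/-- The restriction `N̄` of `N` to length-two words, as a map on pairs. -/
def Normalisation.pair {S : Type*} (Q : Normalisation S) (p : S × S) : S × S :=
  match Q.N [p.1, p.2] with
  | [a, b] => (a, b)
  | _ => p

/-- Apply `F` to the entries at (1-based) positions `i, i+1` of a word. -/
def applyAt {α : Type*} (F : α × α → α × α) : ℕ → List α → List α
  | 1, a :: b :: t => (F (a, b)).1 :: (F (a, b)).2 :: t
  | n + 2, a :: t => a :: applyAt F (n + 1) t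
  | _, l => l

/-- Apply `F` successively at the positions listed in `u` (leftmost entry first):
`F_u = F_{i_n} ∘ ⋯ ∘ F_{i_1}` for `u = i_1|…|i_n`. -/
def applySeq {α : Type*} (F : α × α → α × α) (u : List ℕ) (w : List α) : List α :=
  u.foldl (fun v i => applyAt F i v) w

/-- `altSeq s m` is the alternating sequence of `1`s and `2`s of length `m` starting
with `s`: `altSeq 1 m = 121⋯[m]` and `altSeq 2 m = 212⋯[m]`. -/
def altSeq : ℕ → ℕ → List ℕ
  | _, 0 => []
  | s, m + 1 => s :: altSeq (3 - s) m

/-- A normalisation is quadratic if (i) a word is `N`-normal iff all its length-two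
factors are, and (ii) `N(w)` is always obtained by applying `N̄` at finitely many
positions. -/
def Normalisation.Quadratic {S : Type*} (Q : Normalisation S) : Prop :=
  (∀ w : List S, Q.N w = w ↔
    ∀ u v : List S, ∀ a b : S, w = u ++ [a, b] ++ v → Q.N [a, b] = [a, b]) ∧
  (∀ w : List S, ∃ u : List ℕ, Q.N w = applySeq Q.pair u w)

/-- `(S, N)` is of left class `c`: `N(w) = N̄_{121⋯[c]}(w)` for every length-3 word. -/
def Normalisation.LeftClass {S : Type*} (Q : Normalisation S) (c : ℕ) : Prop :=
  ∀ w : List S, w.length = 3 → Q.N w = applySeq Q.pair (altSeq 1 c) w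

/-- `(S, N)` is of right class `c`: `N(w) = N̄_{212⋯[c]}(w)` for every length-3 word. -/
def Normalisation.RightClass {S : Type*} (Q : Normalisation S) (c : ℕ) : Prop :=
  ∀ w : List S, w.length = 3 → Q.N w = applySeq Q.pair (altSeq 2 c) w

/-- One step of the rewriting system associated with a quadratic normalisation: replace a
non-normal length-two factor `s|t` by `N̄(s|t)`. -/
def NStep {S : Type*} (Q : Normalisation S) (w w' : List S) : Prop :=
  ∃ (u v : List S) (a b : S),
    w = u ++ [a, b] ++ v ∧ Q.N [a, b] ≠ [a, b] ∧ w' = u ++ Q.N [a, b] ++ v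

namespace Normalisation

variable {S : Type*} {Q : Normalisation S}

theorem N_pair (Q : Normalisation S) (a b : S) :
    Q.N [a, b] = [(Q.pair (a, b)).1, (Q.pair (a, b)).2] := by
  obtain ⟨c, d, h⟩ := List.length_eq_two.mp (Q.length_eq [a, b])
  simp [Normalisation.pair, h]

theorem N_idem (Q : Normalisation S) (w : List S) : Q.N (Q.N w) = Q.N w := by
  simpa using Q.compat [] w []

theorem N_cons_N (Q : Normalisation S) (a : S) (w : List S) :
    Q.N (a :: Q.N w) = Q.N (a :: w) := by
  simpa using Q.compat [a] w []

theorem N_pair_pair (Q : Normalisation S) (a b : S) :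
    Q.N [(Q.pair (a, b)).1, (Q.pair (a, b)).2] = [(Q.pair (a, b)).1, (Q.pair (a, b)).2] := by
  rw [← N_pair, N_idem]

theorem Quadratic.normal_cons_cons (hQ : Q.Quadratic) (a b : S) (l : List S) :
    Q.N (a :: b :: l) = a :: b :: l ↔ Q.N [a, b] = [a, b] ∧ Q.N (b :: l) = b :: l := by
  rw [hQ.1 (a :: b :: l), hQ.1 (b :: l)]
  constructor
  · intro h
    refine ⟨h [] l a b rfl, fun u v x y e => h (a :: u) v x y ?_⟩
    simp [e]
  · rintro ⟨h₁, h₂⟩ u v x y e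
    cases u with
    | nil =>
      simp only [List.nil_append, List.cons_append, List.cons.injEq] at e
      obtain ⟨rfl, rfl, -⟩ := e
      exact h₁
    | cons c u =>
      simp only [List.cons_append, List.cons.injEq] at e
      exact h₂ u v x y (by simp [e.2])

/-- The right domino rule: if `b|e` is normal, then applying `N̄` at position `1` and then at
position `2` to `a|b|e` makes the first two letters of the result a normal word. -/
theorem RightClass.domino (h3 : Q.RightClass 3) (hQ : Q.Quadratic) (a : S) {b e : S}
    (hbe : Q.N [b, e] = [b, e]) :
    Q.N [(Q.pair (a, b)).1, (Q.pair ((Q.pair (a, b)).2, e)).1] =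
      [(Q.pair (a, b)).1, (Q.pair ((Q.pair (a, b)).2, e)).1] := by
  have hp : Q.pair (b, e) = (b, e) := by
    have := Q.N_pair b e
    rw [hbe] at this
    simp only [List.cons.injEq, and_true] at this
    exact Prod.ext this.1.symm this.2.symm
  have h := h3 [a, b, e] rfl
  simp only [applySeq, altSeq, List.foldl, applyAt, hp, Nat.reduceSub] at h
  have hn := Q.N_idem [a, b, e]
  rw [h] at hn
  exact ((hQ.normal_cons_cons _ _ _).1 hn).1

theorem RightClass.N_cons_normal (h3 : Q.RightClass 3) (hQ : Q.Quadratic) (c e : S) (v : List S)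
    (hv : Q.N (e :: v) = e :: v) :
    Q.N (c :: e :: v) = (Q.pair (c, e)).1 :: Q.N ((Q.pair (c, e)).2 :: v) := by
  induction v generalizing c e with
  | nil => rw [N_pair, Q.single]
  | cons e₂ v ih =>
    obtain ⟨h₁, h₂⟩ := (hQ.normal_cons_cons _ _ _).1 hv
    have hR : Q.N ((Q.pair (c, e)).1 :: Q.N ((Q.pair (c, e)).2 :: e₂ :: v)) =
        (Q.pair (c, e)).1 :: Q.N ((Q.pair (c, e)).2 :: e₂ :: v) := by
      have hi := Q.N_idem ((Q.pair (c, e)).2 :: e₂ :: v)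
      rw [ih _ _ h₂] at hi ⊢
      exact (hQ.normal_cons_cons _ _ _).2 ⟨h3.domino hQ c h₁, hi⟩
    rw [← hR, N_cons_N]
    simpa [N_pair] using (Q.compat [] [c, e] (e₂ :: v)).symm

/-- `e` is the first letter of the normal form of `w`. -/
def NormalHead (Q : Normalisation S) (w : List S) (e : S) : Prop :=
  ∃ l, Q.N w = e :: l

theorem NormalHead.unique {w : List S} {e e' : S} (h : Q.NormalHead w e)
    (h' : Q.NormalHead w e') : e = e' := by
  obtain ⟨l, h⟩ := h
  obtain ⟨l', h'⟩ := h'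
  simp_all

theorem exists_normalHead (Q : Normalisation S) {w : List S} (hw : w ≠ []) :
    ∃ e, Q.NormalHead w e := by
  have : Q.N w ≠ [] := by
    rw [← List.length_pos_iff, Q.length_eq]
    exact List.length_pos_iff.2 hw
  obtain ⟨e, l, h⟩ := List.exists_cons_of_ne_nil this
  exact ⟨e, l, h⟩

theorem not_normalHead_nil (e : S) : ¬ Q.NormalHead [] e := by
  rintro ⟨l, h⟩
  have := Q.length_eq []
  simp [h] at this

theorem NormalHead.cons (h3 : Q.RightClass 3) (hQ : Q.Quadratic) (c : S) {w : List S} {e : S}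
    (h : Q.NormalHead w e) : Q.NormalHead (c :: w) (Q.pair (c, e)).1 := by
  obtain ⟨l, h⟩ := h
  refine ⟨Q.N ((Q.pair (c, e)).2 :: l), ?_⟩
  rw [← N_cons_N, h]
  exact h3.N_cons_normal hQ c e l (h ▸ Q.N_idem w)

theorem NormalHead.append_normal (h3 : Q.RightClass 3) (hQ : Q.Quadratic) {x y : S}
    (hxy : Q.N [x, y] = [x, y]) (u : List S) {e : S} (h : Q.NormalHead (u ++ [x]) e) :
    Q.NormalHead (u ++ [x, y]) e := by
  induction u generalizing e with
  | nil => exact ⟨[y], h.unique ⟨[], Q.single x⟩ ▸ hxy⟩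
  | cons c u ih =>
    obtain ⟨e₀, h₀⟩ := Q.exists_normalHead (w := u ++ [x]) (by simp)
    rw [h.unique (h₀.cons h3 hQ c)]
    exact (ih h₀).cons h3 hQ c

/-- The letter `b` followed by the first letter of the normal form of any nonempty prefix
of `w` is a normal word. -/
def Dominates (Q : Normalisation S) (b : S) (w : List S) : Prop :=
  ∀ u v : List S, w = u ++ v → ∀ e, Q.NormalHead u e → Q.N [b, e] = [b, e]

theorem dominates_nil (b : S) : Q.Dominates b [] := by
  intro u v h e he
  obtain ⟨rfl, rfl⟩ := List.append_eq_nil_iff.1 h.symm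
  exact (not_normalHead_nil e he).elim

theorem Dominates.normal {b c : S} {w : List S} (h : Q.Dominates b (c :: w)) :
    Q.N [b, c] = [b, c] :=
  h [c] w rfl c ⟨[], Q.single c⟩

theorem Dominates.cons (h3 : Q.RightClass 3) (hQ : Q.Quadratic) (a : S) {b : S} {w : List S}
    (h : Q.Dominates b w) : Q.Dominates (Q.pair (a, b)).1 ((Q.pair (a, b)).2 :: w) := by
  intro u v huv e he
  rcases List.cons_eq_append_iff.1 huv with ⟨rfl, -⟩ | ⟨u, rfl, rfl⟩
  · exact (not_normalHead_nil e he).elim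
  · by_cases hu : u = []
    · subst hu
      rw [he.unique ⟨[], Q.single _⟩]
      exact Q.N_pair_pair a b
    · obtain ⟨e₀, h₀⟩ := Q.exists_normalHead hu
      rw [he.unique (h₀.cons h3 hQ _)]
      exact h3.domino hQ a (h u v rfl e₀ h₀)

theorem Dominates.step (h3 : Q.RightClass 3) (hQ : Q.Quadratic) {b : S} {w w' : List S}
    (h : Q.Dominates b w) (hs : NStep Q w w') : Q.Dominates b w' := by
  obtain ⟨p, q, x, y, rfl, -, rfl⟩ := hs
  intro u v huv e he
  have key : ∀ r, Q.NormalHead (p ++ Q.N [x, y] ++ r) e → Q.NormalHead (p ++ [x, y] ++ r) e := by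
    rintro r ⟨l, hl⟩
    exact ⟨l, by rw [← Q.compat, hl]⟩
  rw [List.append_assoc] at huv
  rcases List.append_eq_append_iff.1 huv with ⟨r, rfl, hr⟩ | ⟨r, rfl, rfl⟩
  · rcases r with _ | ⟨x', _ | ⟨y', r⟩⟩
    · exact h p ([x, y] ++ q) (by simp) e (by simpa using he)
    · have hx : x' = (Q.pair (x, y)).1 := by simp_all [N_pair]
      subst hx
      have := he.append_normal h3 hQ (Q.N_pair_pair x y)
      rw [← N_pair] at this
      exact h (p ++ [x, y]) q rfl e (by simpa using key [] (by simpa using this))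
    · have hx : Q.N [x, y] = [x', y'] ∧ q = r ++ v := by
        rw [N_pair] at hr ⊢
        simp_all
      obtain ⟨hx, rfl⟩ := hx
      refine h (p ++ [x, y] ++ r) v (by simp) e (key r ?_)
      simpa [hx] using he
  · exact h u (r ++ [x, y] ++ q) (by simp) e he

end Normalisation

/-- `RewritesIn Q k w w'`: there is a rewriting sequence with `k` steps from `w` to `w'`. -/
inductive RewritesIn {S : Type*} (Q : Normalisation S) : ℕ → List S → List S → Prop
  | refl (w : List S) : RewritesIn Q 0 w w
  | tail {k : ℕ} {u v w : List S} : RewritesIn Q k u v → NStep Q v w → RewritesIn Q (k + 1) u w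

section Rewriting

variable {S : Type*} {Q : Normalisation S}

theorem NStep.append_right {u v : List S} (h : NStep Q u v) (r : List S) :
    NStep Q (u ++ r) (v ++ r) := by
  obtain ⟨p, q, x, y, rfl, hn, rfl⟩ := h
  exact ⟨p, q ++ r, x, y, by simp, hn, by simp⟩

theorem NStep.cons {u v : List S} (h : NStep Q u v) (a : S) : NStep Q (a :: u) (a :: v) := by
  obtain ⟨p, q, x, y, rfl, hn, rfl⟩ := h
  exact ⟨a :: p, q, x, y, by simp, hn, by simp⟩

theorem RewritesIn.cons {k : ℕ} {u v : List S} (h : RewritesIn Q k u v) (a : S) :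
    RewritesIn Q k (a :: u) (a :: v) := by
  induction h with
  | refl w => exact .refl _
  | tail _ hs ih => exact .tail ih (hs.cons a)

theorem RewritesIn.length_eq {k : ℕ} {u v : List S} (h : RewritesIn Q k u v) :
    u.length = v.length := by
  induction h with
  | refl w => rfl
  | tail _ hs ih =>
    obtain ⟨p, q, x, y, rfl, -, rfl⟩ := hs
    simp [ih, Normalisation.N_pair]

/-- A step on `A ++ b :: U` takes place in `A`, at the last letter of `A` and `b`, at `b` and the
first letter of `U`, or in `U`. -/
theorem NStep.append_cons_cases {A U w : List S} {b : S} (h : NStep Q (A ++ b :: U) w) :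
    (∃ A', NStep Q A A' ∧ w = A' ++ b :: U) ∨
    (∃ A₀ a, A = A₀ ++ [a] ∧
      w = A₀ ++ (Q.pair (a, b)).1 :: (Q.pair (a, b)).2 :: U) ∨
    (∃ c U₀, U = c :: U₀ ∧ Q.N [b, c] ≠ [b, c]) ∨
    (∃ U', NStep Q U U' ∧ w = A ++ b :: U') := by
  obtain ⟨p, q, x, y, he, hn, rfl⟩ := h
  rw [List.append_assoc] at he
  rcases List.append_eq_append_iff.1 he with ⟨r, rfl, hr⟩ | ⟨r, rfl, hr⟩
  · rcases r with _ | ⟨z, r⟩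
    · simp only [List.nil_append, List.cons_append, List.cons.injEq] at hr
      obtain ⟨rfl, rfl⟩ := hr
      exact .inr <| .inr <| .inl ⟨y, q, rfl, hn⟩
    · simp only [List.cons_append, List.cons.injEq] at hr
      obtain ⟨rfl, rfl⟩ := hr
      exact .inr <| .inr <| .inr ⟨r ++ Q.N [x, y] ++ q, ⟨r, q, x, y, by simp, hn, rfl⟩, by simp⟩
  · rcases r with _ | ⟨x', _ | ⟨y', r⟩⟩
    · simp only [List.nil_append, List.cons_append, List.cons.injEq] at hr
      obtain ⟨rfl, rfl⟩ := hr
      exact .inr <| .inr <| .inl ⟨y, q, rfl, hn⟩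
    · simp only [List.nil_append, List.cons_append, List.cons.injEq] at hr
      obtain ⟨rfl, rfl, rfl⟩ := hr
      exact .inr <| .inl ⟨p, x, rfl, by simp [Normalisation.N_pair]⟩
    · simp only [List.nil_append, List.cons_append, List.cons.injEq] at hr
      obtain ⟨rfl, rfl, rfl⟩ := hr
      exact .inl ⟨p ++ Q.N [x, y] ++ r, ⟨p, r, x, y, by simp, hn, rfl⟩, by simp⟩

/-- A rewriting sequence from `P|s` splits into a rewriting sequence from `P`, the steps by which
the influence of `s` moves one letter to the left, and a rewriting sequence on the letters that
this influence has left behind. -/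
theorem RewritesIn.decompose (h3 : Q.RightClass 3) (hQ : Q.Quadratic) {P : List S} {s : S} {k : ℕ}
    {V : List S} (h : RewritesIn Q k (P ++ [s]) V) :
    ∃ (A U R U₀ : List S) (b : S) (k₁ k₂ : ℕ), V = A ++ b :: U ∧ Q.Dominates b U ∧
      R.length = U.length ∧ RewritesIn Q k₁ P (A ++ R) ∧ RewritesIn Q k₂ U₀ U ∧
      k = k₁ + k₂ + U.length := by
  generalize hW : P ++ [s] = W at h
  induction h with
  | refl w =>
    subst hW
    exact ⟨P, [], [], [], s, 0, 0, rfl, Normalisation.dominates_nil s, rfl,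
      by simpa using .refl P, .refl _, rfl⟩
  | tail _ hs ih =>
    obtain ⟨A, U, R, U₀, b, k₁, k₂, rfl, hb, hR, h₁, h₂, rfl⟩ := ih hW
    rcases hs.append_cons_cases with
      ⟨A', hA, rfl⟩ | ⟨A₀, a, rfl, rfl⟩ | ⟨c, U', rfl, hc⟩ | ⟨U', hU, rfl⟩
    · exact ⟨A', U, R, U₀, b, k₁ + 1, k₂, rfl, hb, hR, h₁.tail (hA.append_right R), h₂, by omega⟩
    · exact ⟨A₀, (Q.pair (a, b)).2 :: U, a :: R, (Q.pair (a, b)).2 :: U₀, _, k₁, k₂, rfl,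
        hb.cons h3 hQ a, by simp [hR], by simpa using h₁, h₂.cons _, by simp; omega⟩
    · exact (hc hb.normal).elim
    · have hl : U.length = U'.length := (RewritesIn.tail (.refl U) hU).length_eq
      exact ⟨A, U', R, U₀, b, k₁, k₂ + 1, rfl, hb.step h3 hQ hU, hR.trans hl, h₁, h₂.tail hU,
        by omega⟩

theorem RewritesIn.add_length_succ_le (h3 : Q.RightClass 3) (hQ : Q.Quadratic) {k : ℕ}
    {w w' : List S} (h : RewritesIn Q k w w') : k + w.length + 1 ≤ 2 ^ w.length := by
  induction hn : w.length using Nat.strong_induction_on generalizing k w w' with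
  | _ n ih =>
    rcases List.eq_nil_or_concat' w with rfl | ⟨P, s, rfl⟩
    · obtain rfl : w' = [] := List.length_eq_zero_iff.1 h.length_eq.symm
      obtain rfl : n = 0 := hn.symm
      cases h with
      | refl => simp
      | tail _ hs => obtain ⟨p, q, x, y, -, -, he⟩ := hs; simp [Normalisation.N_pair] at he
    · obtain ⟨A, U, R, U₀, b, k₁, k₂, rfl, -, hR, h₁, h₂, rfl⟩ := h.decompose h3 hQ
      have hP := h₁.length_eq
      have hU := h₂.length_eq
      simp only [List.length_append, List.length_singleton] at hn hP
      have b₁ := ih P.length (by omega) h₁ rfl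
      have b₂ := ih U₀.length (by omega) h₂ rfl
      have hle : U₀.length ≤ P.length := by omega
      have hpow : 2 ^ P.length + 2 ^ P.length = 2 ^ n := by
        rw [← hn, pow_succ, mul_two]
      have : 2 ^ U₀.length ≤ 2 ^ P.length := Nat.pow_le_pow_right two_pos hle
      omega

theorem rewritesIn_of_forall_nstep {f : ℕ → List S} {k : ℕ}
    (h : ∀ i < k, NStep Q (f i) (f (i + 1))) : RewritesIn Q k (f 0) (f k) := by
  induction k with
  | zero => exact .refl _
  | succ k ih => exact (ih fun i hi => h i (by omega)).tail (h k (by omega))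

end Rewriting

/-- If `(S, N)` is a quadratic normalisation of class `(4, 3)`, then the
associated rewriting system is terminating; more precisely, every rewriting sequence from
a word of length `p` has length at most `2^p − p − 1`. -/
theorem quadratic_class43_terminating {S : Type*} (Q : Normalisation S)
    (hQ : Q.Quadratic) (h4 : Q.LeftClass 4) (h3 : Q.RightClass 3) :
    (¬ ∃ f : ℕ → List S, ∀ i : ℕ, NStep Q (f i) (f (i + 1))) ∧
    (∀ (k : ℕ) (f : ℕ → List S), (∀ i < k, NStep Q (f i) (f (i + 1))) →
      k ≤ 2 ^ (f 0).length - (f 0).length - 1) := by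
  have bound : ∀ (k : ℕ) (f : ℕ → List S), (∀ i < k, NStep Q (f i) (f (i + 1))) →
      k ≤ 2 ^ (f 0).length - (f 0).length - 1 := by
    intro k f hf
    have := (rewritesIn_of_forall_nstep hf).add_length_succ_le h3 hQ
    omega
  refine ⟨?_, bound⟩
  rintro ⟨f, hf⟩
  have := bound (2 ^ (f 0).length) f fun i _ => hf i
  have := Nat.one_le_two_pow (n := (f 0).length)
  omega
end
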